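/- Let P(λ) = A_m λ^m + ⋯ + A_1 λ + A_0 be an n×n complex matrix polynomial with det A_m ≠ 0, with nonnegative weights w_0, …, w_m, w_0 > 0, w(t) = Σ w_j t^j. Let λ0 be a simple eigenvalue of P (a root of det P(λ) of multiplicity 1) with unit right and left eigenvectors x0, y0 ∈ ℂ^n, and suppose y0* P'(λ0) x0 ≠ 0; set k(P,λ0) = w(|λ0|)/|y0* P'(λ0) x0|. For ε > 0 let G_ε denote the connected component of the ε-pseudospectrum σ_ε(P) that contains λ0. Then the Hausdorff distance between G_ε and the closed disc {μ ∈ ℂ : |μ − λ0| ≤ k(P,λ0)·ε} is o(ε) as ε → 0⁺, i.e. (Hausdorff distance)/ε → 0 as ε → 0⁺. -/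

import Mathlib

noncomputable section

open Matrix

/-- Euclidean norm of a complex vector. -/
def enorm2 {n : ℕ} (x : Fin n → ℂ) : ℝ := Real.sqrt (∑ i, ‖x i‖ ^ 2)

/-- Spectral norm: the operator norm induced by the Euclidean vector norm. -/
def specNorm {n : ℕ} (A : Matrix (Fin n) (Fin n) ℂ) : ℝ :=
  sSup {r : ℝ | ∃ x : Fin n → ℂ, enorm2 x = 1 ∧ r = enorm2 (A.mulVec x)}

/-- Smallest singular value: the minimum of `‖A x‖` over Euclidean-unit vectors `x`. -/
def sminSV {n : ℕ} (A : Matrix (Fin n) (Fin n) ℂ) : ℝ :=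
  sInf {r : ℝ | ∃ x : Fin n → ℂ, enorm2 x = 1 ∧ r = enorm2 (A.mulVec x)}

/-- Evaluation of the matrix polynomial `P(z) = ∑ A_j z^j`. -/
def evalP {n m : ℕ} (A : Fin (m+1) → Matrix (Fin n) (Fin n) ℂ) (z : ℂ) :
    Matrix (Fin n) (Fin n) ℂ :=
  ∑ j : Fin (m+1), z ^ (j : ℕ) • A j

/-- Derivative `P'(z) = ∑_{j≥1} j A_j z^(j-1)`. -/
def derivP {n m : ℕ} (A : Fin (m+1) → Matrix (Fin n) (Fin n) ℂ) (z : ℂ) :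
    Matrix (Fin n) (Fin n) ℂ :=
  ∑ j : Fin (m+1), (((j : ℕ) : ℂ) * z ^ ((j : ℕ) - 1)) • A j

/-- The scalar polynomial `det P(λ)`. -/
def detPoly {n m : ℕ} (A : Fin (m+1) → Matrix (Fin n) (Fin n) ℂ) : Polynomial ℂ :=
  (Matrix.of fun i k => ∑ j : Fin (m+1), Polynomial.C (A j i k) * Polynomial.X ^ (j : ℕ)).det

/-- The weight polynomial `w(t) = ∑ w_j t^j`. -/
def wval {m : ℕ} (w : Fin (m+1) → ℝ) (t : ℝ) : ℝ := ∑ j : Fin (m+1), w j * t ^ (j : ℕ)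


section helpers
open Filter Topology

theorem aux_lower {E : Type*} [NormedAddCommGroup E] [InnerProductSpace ℂ E] [FiniteDimensional ℂ E]
    (F : ℂ → E →L[ℂ] E) (D : E →L[ℂ] E) (z : ℂ) (hF : HasDerivAt F D z)
    (x0 y0 : E) (hx1 : ‖x0‖ = 1) (hy1 : ‖y0‖ = 1)
    (hy : ∀ x, inner ℂ y0 (F z x) = 0)
    (hker : ∀ x, F z x = 0 → ∃ c : ℂ, x = c • x0) (η : ℝ) (hη : 0 < η) :
    ∀ᶠ u in 𝓝 z, ∀ x, ‖x‖ = 1 → (‖inner ℂ y0 (D x0)‖ - η) * ‖u - z‖ ≤ ‖F u x‖ := by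
  set δ := ‖inner ℂ y0 (D x0)‖ with hδ
  have : ProperSpace E := FiniteDimensional.proper ℂ E
  have hK : IsCompact {x : E | ‖x‖ = 1 ∧ ‖inner ℂ y0 (D x)‖ ≤ δ - η / 2} := by
    apply (isCompact_sphere (0 : E) 1).of_isClosed_subset
    · apply IsClosed.inter
      · exact isClosed_eq continuous_norm continuous_const
      · exact isClosed_le (f := fun x : E => ‖inner ℂ y0 (D x)‖) (by fun_prop) continuous_const
    · rintro x ⟨h, -⟩
      simpa using h
  obtain ⟨c, hc, hcK⟩ := hK.exists_forall_le' (f := fun x => ‖F z x‖) (a := 0) (by fun_prop) (by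
    rintro x ⟨h1, h2⟩
    rw [norm_pos_iff]
    intro h0
    obtain ⟨a, rfl⟩ := hker x h0
    rw [norm_smul, hx1, mul_one] at h1
    rw [map_smul, inner_smul_right, norm_mul, h1, one_mul] at h2
    linarith)
  have e1 : ∀ᶠ u in 𝓝 z, ‖F u - F z‖ < c / 2 := by
    have := hF.continuousAt
    have h2 := Metric.tendsto_nhds.1 this (c/2) (by linarith)
    simpa [dist_eq_norm] using h2
  have e2 : ∀ᶠ u in 𝓝 z, (δ - η) * ‖u - z‖ < c / 2 := by
    have : Tendsto (fun u => (δ - η) * ‖u - z‖) (𝓝 z) (𝓝 ((δ - η) * ‖z - z‖)) :=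
      Continuous.tendsto (by fun_prop) z
    apply this.eventually_lt_const
    simpa using hc
  have e3 := (hasDerivAt_iff_isLittleO.1 hF).def (half_pos hη)
  filter_upwards [e1, e2, e3] with u h1 h2 h3 x hx
  by_cases hxK : ‖inner ℂ y0 (D x)‖ ≤ δ - η / 2
  · have a := hcK x ⟨hx, hxK⟩
    have b : ‖(F u - F z) x‖ ≤ ‖F u - F z‖ := by
      simpa [hx] using (F u - F z).le_opNorm x
    have d : ‖F z x‖ - ‖F u x‖ ≤ ‖(F u - F z) x‖ := by
      rw [_root_.sub_apply, norm_sub_rev]; exact norm_sub_norm_le _ _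
    linarith
  · push Not at hxK
    have b : ‖(F u - F z - (u - z) • D) x‖ ≤ η / 2 * ‖u - z‖ := by
      refine le_trans ?_ h3
      simpa [hx] using (F u - F z - (u - z) • D).le_opNorm x
    have d : inner ℂ y0 (F u x) = (u - z) * inner ℂ y0 (D x)
        + inner ℂ y0 ((F u - F z - (u - z) • D) x) := by
      simp [inner_sub_right, inner_smul_right, hy]
    have e : ‖inner ℂ y0 (F u x)‖ ≤ ‖F u x‖ := by
      simpa [hy1] using norm_inner_le_norm (𝕜 := ℂ) y0 (F u x)
    have f : ‖inner ℂ y0 ((F u - F z - (u - z) • D) x)‖ ≤ η / 2 * ‖u - z‖ := by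
      refine le_trans ?_ b
      simpa only [hy1, one_mul] using norm_inner_le_norm (𝕜 := ℂ) y0 ((F u - F z - (u - z) • D) x)
    have g : ‖(u - z) * inner ℂ y0 (D x)‖ ≤ ‖inner ℂ y0 (F u x)‖ +
        ‖inner ℂ y0 ((F u - F z - (u - z) • D) x)‖ := by
      have : (u - z) * inner ℂ y0 (D x) = inner ℂ y0 (F u x) -
        inner ℂ y0 ((F u - F z - (u - z) • D) x) := by rw [d]; ring
      rw [this]; exact norm_sub_le _ _
    rw [norm_mul] at g
    have := mul_le_mul_of_nonneg_left hxK.le (norm_nonneg (u - z))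
    nlinarith

theorem aux_upper {E : Type*} [NormedAddCommGroup E] [InnerProductSpace ℂ E] [FiniteDimensional ℂ E]
    (F : ℂ → E →L[ℂ] E) (D : E →L[ℂ] E) (z : ℂ) (hF : HasDerivAt F D z)
    (x0 y0 : E) (hx1 : ‖x0‖ = 1) (hy1 : ‖y0‖ = 1)
    (hx : F z x0 = 0)
    (hy : ∀ x, inner ℂ y0 (F z x) = 0)
    (hker : ∀ x, F z x = 0 → ∃ c : ℂ, x = c • x0) (η : ℝ) (hη : 0 < η) :
    ∀ᶠ u in 𝓝 z, ∃ x, ‖x‖ = 1 ∧ ‖F u x‖ ≤ (‖inner ℂ y0 (D x0)‖ + η) * ‖u - z‖ := by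
  set δ := ‖inner ℂ y0 (D x0)‖ with hδ
  have hx0 : x0 ≠ 0 := by rintro rfl; simp at hx1
  have hy0 : y0 ≠ 0 := by rintro rfl; simp at hy1
  have hrange : (F z : E →ₗ[ℂ] E).range = (ℂ ∙ y0)ᗮ := by
    apply Submodule.eq_of_le_of_finrank_eq
    · rintro _ ⟨x, rfl⟩
      rw [Submodule.mem_orthogonal_singleton_iff_inner_right]
      exact hy x
    · have h1 := (F z : E →ₗ[ℂ] E).finrank_range_add_finrank_ker
      have h2 : (F z : E →ₗ[ℂ] E).ker = (ℂ ∙ x0) := by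
        ext x
        rw [Submodule.mem_span_singleton, LinearMap.mem_ker]
        constructor
        · intro h
          obtain ⟨c, rfl⟩ := hker x h
          exact ⟨c, rfl⟩
        · rintro ⟨c, rfl⟩
          simp [hx]
      have h3 := Submodule.finrank_add_finrank_orthogonal (ℂ ∙ y0)
      rw [h2, finrank_span_singleton hx0] at h1
      rw [finrank_span_singleton hy0] at h3
      omega
  obtain ⟨v, hv⟩ : ∃ v, F z v = (inner ℂ y0 (D x0)) • y0 - D x0 := by
    have : (inner ℂ y0 (D x0)) • y0 - D x0 ∈ (F z : E →ₗ[ℂ] E).range := by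
      rw [hrange, Submodule.mem_orthogonal_singleton_iff_inner_right, inner_sub_right,
        inner_smul_right, inner_self_eq_norm_sq_to_K, hy1]
      simp
    exact this
  have hvp : 0 < 1 + ‖v‖ := by positivity
  set τ := η / 2 / (1 + ‖v‖) with hτ
  have hτp : 0 < τ := by positivity
  have hτe : τ * (1 + ‖v‖) = η / 2 := by rw [hτ]; field_simp
  have e1 : ∀ᶠ u in 𝓝 z, ‖F u - F z‖ < τ := by
    have := hF.continuousAt
    have h2 := Metric.tendsto_nhds.1 this τ hτp
    simpa [dist_eq_norm] using h2
  have e2 : ∀ᶠ u in 𝓝 z, (δ + η) * (‖u - z‖ * ‖v‖) < η / 2 := by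
    have : Tendsto (fun u => (δ + η) * (‖u - z‖ * ‖v‖)) (𝓝 z) (𝓝 ((δ + η) * (‖z - z‖ * ‖v‖))) :=
      Continuous.tendsto (by fun_prop) z
    apply this.eventually_lt_const
    simpa using hη
  have e4 : ∀ᶠ u in 𝓝 z, (‖u - z‖ * ‖v‖) < 1 := by
    have : Tendsto (fun u => (‖u - z‖ * ‖v‖)) (𝓝 z) (𝓝 ((‖z - z‖ * ‖v‖))) :=
      Continuous.tendsto (by fun_prop) z
    apply this.eventually_lt_const
    simp
  have e3 := (hasDerivAt_iff_isLittleO.1 hF).def hτp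
  filter_upwards [e1, e2, e3, e4] with u h1 h2 h3 h4
  set x := x0 + (u - z) • v with hxdef
  have hxn : 1 - ‖u - z‖ * ‖v‖ ≤ ‖x‖ := by
    have := norm_sub_le x ((u - z) • v)
    rw [hxdef, add_sub_cancel_right, ← hxdef, hx1, norm_smul] at this
    linarith
  have hxpos : 0 < ‖x‖ := by linarith
  have hFx : F u x = (u - z) • ((inner ℂ y0 (D x0)) • y0) +
      ((F u - F z - (u - z) • D) x0 + (u - z) • ((F u - F z) v)) := by
    simp [hxdef, hx, hv, smul_sub]
    abel
  have b1 : ‖(F u - F z - (u - z) • D) x0‖ ≤ τ * ‖u - z‖ := by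
    refine le_trans ?_ h3
    simpa [hx1] using (F u - F z - (u - z) • D).le_opNorm x0
  have b2 : ‖(F u - F z) v‖ ≤ τ * ‖v‖ :=
    ((F u - F z).le_opNorm v).trans (by gcongr)
  have b3 : ‖F u x‖ ≤ ‖u - z‖ * (δ + η / 2) := by
    rw [hFx]
    refine (norm_add_le _ _).trans ?_
    have := norm_add_le ((F u - F z - (u - z) • D) x0) ((u - z) • ((F u - F z) v))
    rw [norm_smul] at this
    rw [norm_smul, norm_smul, hy1, mul_one, ← hδ]
    have := mul_le_mul_of_nonneg_left b2 (norm_nonneg (u - z))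
    rw [← hτe]
    nlinarith
  refine ⟨((‖x‖⁻¹ : ℝ) : ℂ) • x, ?_, ?_⟩
  · rw [norm_smul]; simp [hxpos.ne']
  · rw [map_smul, norm_smul]
    have : ‖((‖x‖⁻¹ : ℝ) : ℂ)‖ = ‖x‖⁻¹ := by simp
    rw [this, inv_mul_le_iff₀ hxpos]
    refine b3.trans ?_
    have hδ0 : 0 ≤ δ := norm_nonneg _
    have k1 : (δ + η / 2) ≤ (δ + η) * ‖x‖ := by nlinarith
    nlinarith [mul_le_mul_of_nonneg_left k1 (norm_nonneg (u - z))]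

theorem aux_final (s W : ℂ → ℝ) (z : ℂ) (δ : ℝ) (hδ : 0 < δ) (hW : ContinuousAt W z)
    (hWp : 0 < W z)
    (hl : ∀ η > 0, ∀ᶠ u in 𝓝 z, (δ - η) * ‖u - z‖ ≤ s u)
    (hu : ∀ η > 0, ∀ᶠ u in 𝓝 z, s u ≤ (δ + η) * ‖u - z‖) :
    Tendsto (fun ε : ℝ => Metric.hausdorffDist
      (connectedComponentIn {u : ℂ | s u ≤ ε * W u} z)
      (Metric.closedBall z ((W z / δ) * ε)) / ε) (𝓝[>] 0) (𝓝 0) := by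
  set k := W z / δ with hk
  have hkp : 0 < k := by positivity
  have hkd : k * δ = W z := by rw [hk]; field_simp
  have main : ∀ η, 0 < η → η < k → ∀ᶠ ε in 𝓝[>] (0:ℝ), Metric.hausdorffDist
      (connectedComponentIn {u : ℂ | s u ≤ ε * W u} z)
      (Metric.closedBall z (k * ε)) ≤ η * ε := by
    intro η hη hηk
    set τ := δ * η / (2 * (k + η + 1)) with hτ
    have hτp : 0 < τ := by positivity
    have hτe : τ * (k + η + 1) = δ * η / 2 := by rw [hτ]; field_simp
    have hWe : ∀ᶠ u in 𝓝 z, |W u - W z| < τ := by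
      simpa [Real.dist_eq] using Metric.tendsto_nhds.1 hW τ hτp
    obtain ⟨ρ, hρ, hball⟩ := Metric.eventually_nhds_iff.1 ((hl τ hτp).and ((hu τ hτp).and hWe))
    have he : ∀ᶠ ε in 𝓝[>] (0:ℝ), (k + η) * ε < ρ := by
      have : Tendsto (fun ε : ℝ => (k + η) * ε) (𝓝[>] 0) (𝓝 ((k + η) * 0)) :=
        (Continuous.tendsto (by fun_prop) 0).mono_left nhdsWithin_le_nhds
      apply this.eventually_lt_const
      simpa using hρ
    filter_upwards [he, self_mem_nhdsWithin] with ε h1 (hε : 0 < ε)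
    set S := {u : ℂ | s u ≤ ε * W u} with hS
    have inner_sub : Metric.closedBall z ((k - η) * ε) ⊆ S := by
      intro u hu
      rw [Metric.mem_closedBall] at hu
      have hd : dist u z < ρ := by nlinarith
      obtain ⟨-, a2, a3⟩ := hball hd
      rw [dist_eq_norm] at hu
      rw [abs_lt] at a3
      have : (δ + τ) * ‖u - z‖ ≤ (δ + τ) * ((k - η) * ε) := by gcongr
      have h3 : (δ + τ) * (k - η) ≤ W u := by nlinarith
      have h4 := mul_le_mul_of_nonneg_left h3 hε.le
      show s u ≤ ε * W u
      nlinarith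
    have hz : z ∈ Metric.closedBall z ((k - η) * ε) :=
      Metric.mem_closedBall_self (mul_nonneg (by linarith) hε.le)
    have inner_comp : Metric.closedBall z ((k - η) * ε) ⊆ connectedComponentIn S z :=
      (convex_closedBall z _).isPreconnected.subset_connectedComponentIn hz inner_sub
    have outer : connectedComponentIn S z ⊆ Metric.closedBall z ((k + η) * ε) := by
      intro u hu
      by_contra hcon
      rw [Metric.mem_closedBall, not_le] at hcon
      have hiv := (isPreconnected_connectedComponentIn (F := S) (x := z)).intermediate_value
        (inner_comp hz) hu (f := fun v => dist v z) (by fun_prop)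
      obtain ⟨v, hv, hvd⟩ := hiv (show (k + η) * ε ∈ _ from
        ⟨by simp only [dist_self]; positivity, hcon.le⟩)
      have hvS : s v ≤ ε * W v := (connectedComponentIn_subset S z) hv
      simp only at hvd
      obtain ⟨a1, -, a3⟩ := hball (by rw [hvd]; exact h1)
      rw [← dist_eq_norm, hvd] at a1
      rw [abs_lt] at a3
      have h3 : W v < (δ - τ) * (k + η) := by nlinarith [mul_pos hδ hη]
      have h4 := mul_lt_mul_of_pos_left h3 hε
      nlinarith
    apply Metric.hausdorffDist_le_of_mem_dist (by positivity)
    · intro u hu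
      have h := outer hu
      rw [Metric.mem_closedBall, dist_eq_norm] at h
      refine ⟨z + ((k / (k + η) : ℝ) : ℂ) * (u - z), ?_, ?_⟩
      · rw [Metric.mem_closedBall, dist_eq_norm, add_sub_cancel_left, norm_mul, Complex.norm_real,
          Real.norm_of_nonneg (by positivity), div_mul_eq_mul_div, div_le_iff₀ (by positivity)]
        nlinarith
      · have : u - (z + ((k / (k + η) : ℝ) : ℂ) * (u - z)) =
            ((η / (k + η) : ℝ) : ℂ) * (u - z) := by
          have : (η / (k + η) : ℝ) = 1 - k / (k + η) := by field_simp; ring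
          rw [this]; push_cast; ring
        rw [dist_eq_norm, this, norm_mul, Complex.norm_real,
          Real.norm_of_nonneg (by positivity), div_mul_eq_mul_div, div_le_iff₀ (by positivity)]
        nlinarith
    · intro u h
      rw [Metric.mem_closedBall, dist_eq_norm] at h
      have hkη : 0 ≤ (k - η) / k := div_nonneg (by linarith) hkp.le
      refine ⟨z + (((k - η) / k : ℝ) : ℂ) * (u - z), inner_comp ?_, ?_⟩
      · rw [Metric.mem_closedBall, dist_eq_norm, add_sub_cancel_left, norm_mul, Complex.norm_real,
          Real.norm_of_nonneg hkη, div_mul_eq_mul_div, div_le_iff₀ (by positivity)]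
        nlinarith
      · have : u - (z + (((k - η) / k : ℝ) : ℂ) * (u - z)) =
            ((η / k : ℝ) : ℂ) * (u - z) := by
          have : (η / k : ℝ) = 1 - (k - η) / k := by field_simp; ring
          rw [this]; push_cast; ring
        rw [dist_eq_norm, this, norm_mul, Complex.norm_real,
          Real.norm_of_nonneg (by positivity), div_mul_eq_mul_div, div_le_iff₀ (by positivity)]
        nlinarith
  rw [Metric.tendsto_nhds]
  intro r hr
  have hm : 0 < min (r / 2) (k / 2) := by positivity
  filter_upwards [main (min (r / 2) (k / 2)) hm
    (lt_of_le_of_lt (min_le_right _ _) (by linarith)), self_mem_nhdsWithin] with ε h1 (hε : 0 < ε)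
  rw [Real.dist_eq, sub_zero, abs_of_nonneg (div_nonneg Metric.hausdorffDist_nonneg hε.le),
    div_lt_iff₀ hε]
  have := min_le_left (r / 2) (k / 2)
  nlinarith

theorem aux_ker {n m : ℕ} (A : Fin (m+1) → Matrix (Fin n) (Fin n) ℂ) (z : ℂ)
    (hs : Polynomial.rootMultiplicity z (detPoly A) = 1)
    (x0 : Fin n → ℂ) (hx0 : x0 ≠ 0) (hx : (evalP A z).mulVec x0 = 0)
    (x : Fin n → ℂ) (hxx : (evalP A z).mulVec x = 0) : ∃ c : ℂ, x = c • x0 := by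
  by_contra hcon
  push Not at hcon
  have hn : 0 < n := by
    rcases Nat.eq_zero_or_pos n with h | h
    · subst h; exact absurd (Subsingleton.elim _ _) hx0
    · exact h
  set M : Matrix (Fin n) (Fin n) (Polynomial ℂ) :=
    Matrix.of fun i k => ∑ j : Fin (m+1), Polynomial.C (A j i k) * Polynomial.X ^ (j : ℕ) with hM
  have hMe : (Polynomial.evalRingHom z).mapMatrix M = evalP A z := by
    ext i k
    show Polynomial.eval z (∑ j : Fin (m+1), Polynomial.C (A j i k) * Polynomial.X ^ (j : ℕ)) = _
    rw [Polynomial.eval_finsetSum, evalP, Matrix.sum_apply]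
    refine Finset.sum_congr rfl fun j _ => ?_
    simp only [Polynomial.eval_mul, Polynomial.eval_C, Polynomial.eval_pow, Polynomial.eval_X,
      Matrix.smul_apply, smul_eq_mul]
    exact mul_comm _ _
  have hadj : (evalP A z).adjugate = 0 := by
    ext i j
    rw [Matrix.adjugate_apply, Matrix.zero_apply]
    apply Matrix.exists_mulVec_eq_zero_iff.1
    -- a kernel vector vanishing at i
    obtain ⟨v, hv0, hv, hvi⟩ : ∃ v : Fin n → ℂ, v ≠ 0 ∧ (evalP A z).mulVec v = 0 ∧ v i = 0 := by
      by_cases h : x0 i = 0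
      · exact ⟨x0, hx0, hx, h⟩
      · refine ⟨x - (x i / x0 i) • x0, ?_, ?_, ?_⟩
        · exact sub_ne_zero.2 (hcon _)
        · rw [Matrix.mulVec_sub, Matrix.mulVec_smul, hx, hxx]; simp
        · simp [h]
    refine ⟨v, hv0, ?_⟩
    ext l
    by_cases hl : l = j
    · subst hl
      simp [Matrix.mulVec, hvi]
    · have := congrFun hv l
      simpa [Matrix.mulVec, Matrix.updateRow_ne hl] using this
  have hdvd : ∀ i j, ∃ q, M.adjugate i j = (Polynomial.X - Polynomial.C z) * q := by
    intro i j
    have h1 := RingHom.map_adjugate (Polynomial.evalRingHom z) M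
    rw [hMe, hadj] at h1
    have h2 := congrFun (congrFun h1 i) j
    exact Polynomial.dvd_iff_isRoot.2 (by simpa using h2)
  choose q hq using hdvd
  have hMN : M.adjugate = (Polynomial.X - Polynomial.C z) • Matrix.of q := by
    ext1 i j
    rw [hq]; simp
  have hdet := Matrix.det_adjugate M
  rw [hMN, Matrix.det_smul, Fintype.card_fin] at hdet
  have hd : M.det = detPoly A := rfl
  rw [hd] at hdet
  have hne : detPoly A ≠ 0 := by
    intro h; rw [h] at hs; simp at hs
  have hle : n ≤ Polynomial.rootMultiplicity z (detPoly A ^ (n - 1)) := by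
    rw [Polynomial.le_rootMultiplicity_iff (pow_ne_zero _ hne)]
    exact ⟨_, hdet.symm⟩
  have : Polynomial.rootMultiplicity z (detPoly A ^ (n - 1)) = n - 1 := by
    rw [← Polynomial.count_roots, Polynomial.roots_pow, Multiset.count_nsmul,
      Polynomial.count_roots, hs, mul_one]
  omega

theorem enorm2_eq {n : ℕ} (x : Fin n → ℂ) : enorm2 x = ‖WithLp.toLp 2 x‖ := by
  rw [EuclideanSpace.norm_eq]; rfl

end helpers

/-- Proposition 3.1: for a simple eigenvalue `λ0` of `P`, the Hausdorff
distance between the connected component of the `ε`-pseudospectrum containing `λ0` and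
the disc of radius `k(P,λ0) ε` about `λ0` is `o(ε)` as `ε → 0⁺`. -/
theorem stmt8 {n m : ℕ}
    (A : Fin (m+1) → Matrix (Fin n) (Fin n) ℂ)
    (hAm : (A (Fin.last m)).det ≠ 0)
    (w : Fin (m+1) → ℝ) (hw : ∀ j, 0 ≤ w j) (hw0 : 0 < w 0)
    (lam0 : ℂ)
    (hsimple : Polynomial.rootMultiplicity lam0 (detPoly A) = 1)
    (x0 y0 : Fin n → ℂ)
    (hx1 : enorm2 x0 = 1) (hy1 : enorm2 y0 = 1)
    (hx : (evalP A lam0).mulVec x0 = 0)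
    (hy : Matrix.vecMul (star y0) (evalP A lam0) = 0)
    (hδ : star y0 ⬝ᵥ (derivP A lam0).mulVec x0 ≠ 0) :
    Filter.Tendsto
      (fun ε : ℝ =>
        Metric.hausdorffDist
            (connectedComponentIn
              {μ : ℂ | sminSV (evalP A μ) ≤ ε * wval w ‖μ‖} lam0)
            (Metric.closedBall lam0
              ((wval w ‖lam0‖ /
                  ‖star y0 ⬝ᵥ (derivP A lam0).mulVec x0‖) * ε)) / ε)
      (nhdsWithin 0 (Set.Ioi 0)) (nhds 0) := by
  set T := Matrix.toEuclideanCLM (n := Fin n) (𝕜 := ℂ) with hT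
  set F : ℂ → EuclideanSpace ℂ (Fin n) →L[ℂ] EuclideanSpace ℂ (Fin n) :=
    fun u => T (evalP A u) with hFdef
  have hTa : ∀ (B : Matrix (Fin n) (Fin n) ℂ) (x : Fin n → ℂ),
      T B (WithLp.toLp 2 x) = WithLp.toLp 2 (B.mulVec x) := by
    intro B x; rfl
  have hFe : F = fun u => ∑ j : Fin (m+1), u ^ (j : ℕ) • T (A j) := by
    ext1 u
    simp [hFdef, evalP, map_sum, map_smul]
  have hF : HasDerivAt F (T (derivP A lam0)) lam0 := by
    have : T (derivP A lam0) =
        ∑ j : Fin (m+1), (((j : ℕ) : ℂ) * lam0 ^ ((j : ℕ) - 1)) • T (A j) := by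
      simp only [derivP, map_sum, map_smul]
    rw [hFe, this]
    refine HasDerivAt.fun_sum fun j _ => ?_
    exact (hasDerivAt_pow (j : ℕ) lam0).smul_const (T (A j))
  have hinner : ∀ a b : Fin n → ℂ, inner ℂ (WithLp.toLp 2 a) (WithLp.toLp 2 b) = star a ⬝ᵥ b := by
    intro a b
    rw [EuclideanSpace.inner_toLp_toLp, dotProduct_comm]
  have hx0 : x0 ≠ 0 := by
    rintro rfl; simp [enorm2] at hx1
  have hX1 : ‖WithLp.toLp 2 x0‖ = 1 := by rw [← enorm2_eq, hx1]
  have hY1 : ‖WithLp.toLp 2 y0‖ = 1 := by rw [← enorm2_eq, hy1]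
  have hX : F lam0 (WithLp.toLp 2 x0) = 0 := by
    simp [hFdef, hTa, hx]
  have hY : ∀ x, inner ℂ (WithLp.toLp 2 y0) (F lam0 x) = 0 := by
    intro x
    obtain ⟨x, rfl⟩ := (WithLp.toLp_surjective 2) x
    simp only [hFdef, hTa, hinner]
    rw [Matrix.dotProduct_mulVec, hy, zero_dotProduct]
  have hker : ∀ x, F lam0 x = 0 → ∃ c : ℂ, x = c • WithLp.toLp 2 x0 := by
    intro x h
    obtain ⟨x, rfl⟩ := (WithLp.toLp_surjective 2) x
    simp only [hFdef, hTa] at h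
    obtain ⟨c, hc⟩ := aux_ker A lam0 hsimple x0 hx0 hx x (by simpa using h)
    exact ⟨c, by rw [hc]; rfl⟩
  have hδe : ‖inner ℂ (WithLp.toLp 2 y0) (T (derivP A lam0) (WithLp.toLp 2 x0))‖ =
      ‖star y0 ⬝ᵥ (derivP A lam0).mulVec x0‖ := by rw [hTa, hinner]
  have hWc : Continuous (fun u : ℂ => wval w ‖u‖) := by
    unfold wval; fun_prop
  apply aux_final (fun u => sminSV (evalP A u)) (fun u => wval w ‖u‖) lam0 _
    (norm_pos_iff.2 hδ) hWc.continuousAt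
  · show 0 < wval w ‖lam0‖
    unfold wval
    apply Finset.sum_pos' (fun j _ => mul_nonneg (hw j) (by positivity))
    exact ⟨0, Finset.mem_univ _, by simpa using hw0⟩
  · intro η hη
    have := aux_lower F _ lam0 hF _ _ hX1 hY1 hY hker η hη
    rw [hδe] at this
    filter_upwards [this] with u hu
    refine le_csInf (Set.nonempty_of_mem (x := enorm2 ((evalP A u).mulVec x0)) ⟨x0, hx1, rfl⟩) ?_
    rintro _ ⟨x, h1, rfl⟩
    rw [enorm2_eq] at h1 ⊢
    exact hu _ h1
  · intro η hη
    have := aux_upper F _ lam0 hF _ _ hX1 hY1 hX hY hker η hη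
    rw [hδe] at this
    filter_upwards [this] with u hu
    obtain ⟨x, h1, h2⟩ := hu
    obtain ⟨x, rfl⟩ := (WithLp.toLp_surjective 2) x
    refine le_trans (csInf_le (a := enorm2 ((evalP A u).mulVec x)) ⟨0, ?_⟩ ⟨x, by rw [enorm2_eq, h1], rfl⟩) ?_
    · rintro _ ⟨y, -, rfl⟩
      exact Real.sqrt_nonneg _
    · rw [enorm2_eq]; exact h2
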